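/- Let A ∈ ℂ^{d×d} be Hermitian, S ∈ ℂ^{d×m}, b ∈ ℂ^d, and set Ã = Sᴴ A S, b̃ = Sᴴ b. Let B̃ be the Moore–Penrose pseudo-inverse of Ã. Suppose that for some t ≥ 1 the vector x̃ ∈ ℂ^m belongs to the Krylov subspace K_t(Ã, b̃) and the residual r̃ = b̃ − Ã x̃ satisfies Ã r̃ = 0. Set x = S x̃ and r = b − A x, and assume S r̃ ≠ 0. Then ⟨S r̃, r⟩ = ‖r̃‖², and the lifted vector x − (⟨r, x⟩ / ⟨S r̃, r⟩) · S r̃ equals S B̃ b̃. -/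

import Mathlib

open Matrix

/-- `B` is the Moore–Penrose pseudo-inverse of `A`. -/
def IsMoorePenrose {n m : Type*} [Fintype n] [Fintype m]
    (A : Matrix n m ℂ) (B : Matrix m n ℂ) : Prop :=
  A * B * A = A ∧ B * A * B = B ∧ (A * B)ᴴ = A * B ∧ (B * A)ᴴ = B * A

/-- The Krylov subspace `K_t(A, b) = span {b, Ab, …, A^{t-1} b}`. -/
noncomputable def Krylov {n : Type*} [Fintype n] [DecidableEq n]
    (A : Matrix n n ℂ) (b : n → ℂ) (t : ℕ) : Submodule ℂ (n → ℂ) :=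
  Submodule.span ℂ {v | ∃ i < t, v = (A ^ i).mulVec b}

theorem krylov_decomp {m : ℕ} (M : Matrix (Fin m) (Fin m) ℂ) (b x : Fin m → ℂ) (t : ℕ)
    (hx : x ∈ Krylov M b t) : ∃ (a : ℂ) (w : Fin m → ℂ), x = a • b + M.mulVec w := by
  unfold Krylov at hx
  induction hx using Submodule.span_induction with
  | mem v hv =>
    obtain ⟨i, _, rfl⟩ := hv
    cases i with
    | zero => exact ⟨1, 0, by simp⟩
    | succ k => exact ⟨0, (M ^ k).mulVec b, by simp [pow_succ', Matrix.mulVec_mulVec]⟩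
  | zero => exact ⟨0, 0, by simp⟩
  | add u v _ _ hu hv =>
    obtain ⟨a, w, rfl⟩ := hu
    obtain ⟨a', w', rfl⟩ := hv
    exact ⟨a + a', w + w', by rw [Matrix.mulVec_add]; module⟩
  | smul c u _ hu =>
    obtain ⟨a, w, rfl⟩ := hu
    exact ⟨c * a, c • w, by rw [Matrix.mulVec_smul]; module⟩

open scoped ComplexOrder in
theorem dot_self_zero {m : ℕ} (u : Fin m → ℂ) (h : star u ⬝ᵥ u = 0) : u = 0 :=
  dotProduct_star_self_eq_zero.mp h

theorem star_mulVec_dot {d m : ℕ} (S : Matrix (Fin d) (Fin m) ℂ) (u : Fin m → ℂ)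
    (v : Fin d → ℂ) : star (S.mulVec u) ⬝ᵥ v = star u ⬝ᵥ Sᴴ.mulVec v := by
  rw [Matrix.star_mulVec, Matrix.dotProduct_mulVec]

/-- Lifting for preconditioned Hermitian systems with `Ã = Sᴴ A S`, `b̃ = Sᴴ b`:
the lifted vector equals `S Ã† b̃`. -/
theorem lifting_preconditioned_hermitian {d m : ℕ}
    (A : Matrix (Fin d) (Fin d) ℂ) (S : Matrix (Fin d) (Fin m) ℂ)
    (Bt : Matrix (Fin m) (Fin m) ℂ)
    (b : Fin d → ℂ) (xt : Fin m → ℂ) (t : ℕ)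
    (ht : 1 ≤ t)
    (hA : A.IsHermitian)
    (hBt : IsMoorePenrose (Sᴴ * A * S) Bt)
    (hx : xt ∈ Krylov (Sᴴ * A * S) (Sᴴ.mulVec b) t)
    (rt : Fin m → ℂ)
    (hrt : rt = Sᴴ.mulVec b - (Sᴴ * A * S).mulVec xt)
    (hls : (Sᴴ * A * S).mulVec rt = 0)
    (x r : Fin d → ℂ)
    (hxdef : x = S.mulVec xt)
    (hrdef : r = b - A.mulVec x)
    (hSrt : S.mulVec rt ≠ 0) :
    star (S.mulVec rt) ⬝ᵥ r = star rt ⬝ᵥ rt ∧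
      x - ((star r ⬝ᵥ x) / (star (S.mulVec rt) ⬝ᵥ r)) • S.mulVec rt
        = S.mulVec (Bt.mulVec (Sᴴ.mulVec b)) := by
  have hMH : (Sᴴ * A * S)ᴴ = Sᴴ * A * S := by
    simp [Matrix.conjTranspose_mul, hA.eq, Matrix.mul_assoc]
  have hSr : Sᴴ.mulVec r = rt := by
    rw [hrt, hrdef, hxdef, Matrix.mulVec_sub]
    simp [Matrix.mulVec_mulVec, Matrix.mul_assoc]
  have h1 : star (S.mulVec rt) ⬝ᵥ r = star rt ⬝ᵥ rt := by
    rw [star_mulVec_dot, hSr]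
  have h2 : star r ⬝ᵥ x = star rt ⬝ᵥ xt := by
    have := star_mulVec_dot Sᴴ r xt
    rw [hSr, Matrix.conjTranspose_conjTranspose] at this
    rw [this, hxdef]
  refine ⟨h1, ?_⟩
  rw [h1, h2]
  obtain ⟨a, w, hw⟩ := krylov_decomp _ _ _ _ hx
  generalize Sᴴ * A * S = M at *
  generalize Sᴴ.mulVec b = bt at *
  obtain ⟨p1, p2, p3, p4⟩ := hBt
  have hb : bt = rt + M.mulVec xt := by rw [hrt]; abel
  have hrt0 : star rt ⬝ᵥ rt ≠ 0 := by
    intro h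
    replace h := dot_self_zero rt h
    exact hSrt (by rw [h, Matrix.mulVec_zero])
  have hx' : xt = a • rt + M.mulVec (a • xt + w) := by
    rw [Matrix.mulVec_add, Matrix.mulVec_smul]
    conv_lhs => rw [hw, hb]
    module
  generalize a • xt + w = w' at hx'
  have hPM : Bt * M * M = M := by
    have := congrArg Matrix.conjTranspose p1
    rwa [Matrix.mul_assoc, Matrix.conjTranspose_mul, p4, hMH] at this
  have hBr : Bt.mulVec rt = 0 := by
    have e : M * Bt = Btᴴ * M := by rw [← p3, Matrix.conjTranspose_mul, hMH]
    rw [← p2, Matrix.mul_assoc, e, ← Matrix.mulVec_mulVec, ← Matrix.mulVec_mulVec, hls]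
    simp
  have hdot : star rt ⬝ᵥ xt = a * (star rt ⬝ᵥ rt) := by
    have := star_mulVec_dot M rt w'
    rw [hls, hMH] at this
    rw [hx', dotProduct_add, ← this]
    simp
  have hBb : Bt.mulVec bt = M.mulVec w' := by
    rw [hb, Matrix.mulVec_add, hBr, hx', Matrix.mulVec_add, Matrix.mulVec_smul, hls]
    simp [Matrix.mulVec_mulVec, ← Matrix.mul_assoc, hPM]
  rw [hBb, hdot, mul_div_cancel_right₀ _ hrt0, hxdef, ← Matrix.mulVec_smul, ← Matrix.mulVec_sub]
  congr 1
  rw [sub_eq_iff_eq_add, add_comm]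
  exact hx'
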